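/- Let α > 0 and C > e^{2α}, and let Λ_{Ce^{−α·}} be the envelope class of the function f(x) = min(1, C·e^{−αx}). Then there exists a constant B (depending only on C and α) such that for all integers n ≥ 2, R*(Λ_{Ce^{−α·}}^n) ≤ (1/(2α))·(log n)² + B; in particular R+(Λ_{Ce^{−α·}}^n) ≤ (1/(2α))·(log n)² + B as well. -/

import Mathlib

open scoped ENNReal BigOperators

noncomputable section

/-- `p` is a probability mass function on `α`. -/
def IsPmf {α : Type*} (p : α → ℝ) : Prop := (∀ a, 0 ≤ p a) ∧ HasSum p 1

/-- The `n`-fold product probability mass function. -/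
def prodPmf {α : Type*} (p : α → ℝ) (n : ℕ) : (Fin n → α) → ℝ :=
  fun x => ∏ i, p (x i)

/-- base-2 logarithm of the ratio `a / b`, valued in `[0,∞]`:
it is `⊤` when `b = 0 < a`, and clipped at `0` from below (which does not affect
the suprema defining minimax regret, which are always nonnegative). -/
def regretTerm (a b : ℝ) : ℝ≥0∞ :=
  if a ≤ 0 then 0 else if b ≤ 0 then ⊤ else ENNReal.ofReal (Real.logb 2 (a / b))

/-- Minimax regret (base 2) of the class `Λ` for word length `n`, valued in `[0,∞]`. -/
def minimaxRegret {α : Type*} (Λ : Set (α → ℝ)) (n : ℕ) : ℝ≥0∞ :=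
  ⨅ (Q : (Fin n → α) → ℝ) (_ : IsPmf Q),
    ⨆ (x : Fin n → α), ⨆ P ∈ Λ, regretTerm (prodPmf P n x) (Q x)

/- Kullback-Leibler divergence `D(p‖q)` in base 2, valued in `[0,∞]`.
It is `⊤` unless `q` dominates `p`; otherwise it is computed through the
pointwise-nonnegative decomposition `p log(p/q) + q - p` (summing to
`Σ p log(p/q)` since `Σ p = Σ q = 1`), converted from nats to bits. -/
open Classical in
def klDiv2 {α : Type*} (p q : α → ℝ) : ℝ≥0∞ :=
  if ∃ a, q a = 0 ∧ 0 < p a then ⊤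
  else (∑' a, ENNReal.ofReal (p a * Real.log (p a / q a) + q a - p a)) /
       ENNReal.ofReal (Real.log 2)

/-- Minimax redundancy (base 2) of the class `Λ` for word length `n`, valued in `[0,∞]`. -/
def minimaxRedundancy {α : Type*} (Λ : Set (α → ℝ)) (n : ℕ) : ℝ≥0∞ :=
  ⨅ (Q : (Fin n → α) → ℝ) (_ : IsPmf Q), ⨆ P ∈ Λ, klDiv2 (prodPmf P n) Q

/-- The envelope class defined by the envelope function `f`. -/
def envClass (f : ℕ+ → ℝ) : Set (ℕ+ → ℝ) := {P | IsPmf P ∧ ∀ k, P k ≤ f k}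

theorem prodPmf_nonneg {α : Type*} {p : α → ℝ} (hp : ∀ a, 0 ≤ p a) (n : ℕ) (x : Fin n → α) :
    0 ≤ prodPmf p n x :=
  Finset.prod_nonneg fun i _ => hp (x i)

theorem hasSum_prodPmf {α : Type*} {p : α → ℝ} {s : ℝ} (hp : ∀ a, 0 ≤ p a) (hs : HasSum p s)
    (n : ℕ) : HasSum (prodPmf p n) (s ^ n) := by
  induction n with
  | zero => simpa [prodPmf] using hasSum_unique (prodPmf p 0)
  | succ n ih =>
    have h := hs.mul ih (hs.summable.mul_of_nonneg ih.summable hp (prodPmf_nonneg hp n))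
    rw [← (Fin.consEquiv fun _ : Fin (n + 1) => α).hasSum_iff, pow_succ']
    refine h.congr_fun ?_
    rintro ⟨a, x⟩
    simp [prodPmf, Fin.prod_univ_succ, Fin.consEquiv]

theorem regretTerm_le_of_le_mul {a b M : ℝ} (hM : 0 < M) (h : a ≤ M * b) :
    regretTerm a b ≤ ENNReal.ofReal (Real.logb 2 M) := by
  unfold regretTerm
  split_ifs with ha hb
  · exact zero_le
  · nlinarith
  · push Not at ha hb
    refine ENNReal.ofReal_le_ofReal (Real.logb_le_logb_of_le one_lt_two (by positivity) ?_)
    rwa [div_le_iff₀ hb]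

theorem klDiv2_le_of_le_mul {α : Type*} {p q : α → ℝ} (hp : IsPmf p) (hq : IsPmf q) {M : ℝ}
    (hM : 0 < M) (h : ∀ a, p a ≤ M * q a) :
    klDiv2 p q ≤ ENNReal.ofReal (Real.logb 2 M) := by
  have hlog2 : 0 < Real.log 2 := Real.log_pos one_lt_two
  unfold klDiv2
  rw [if_neg]
  swap
  · rintro ⟨a, hqa, hpa⟩
    have := h a
    rw [hqa] at this
    linarith
  rw [Real.logb, ENNReal.ofReal_div_of_pos hlog2]
  refine ENNReal.div_le_div_right ?_ _
  have key : ∀ a, 0 ≤ p a * Real.log (p a / q a) + q a - p a ∧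
      p a * Real.log (p a / q a) + q a - p a ≤ p a * Real.log M + q a - p a := by
    intro a
    rcases (hp.1 a).eq_or_lt with hpa | hpa
    · simp [← hpa, hq.1 a]
    · have hqa : 0 < q a := by
        by_contra! hc
        have := h a
        nlinarith
      constructor
      · have h1 := Real.one_sub_inv_le_log_of_pos (div_pos hpa hqa)
        have h2 := mul_le_mul_of_nonneg_left h1 hpa.le
        have h3 : p a * (1 - (p a / q a)⁻¹) = p a - q a := by
          field_simp
        linarith
      · have h1 : Real.log (p a / q a) ≤ Real.log M :=
          Real.log_le_log (div_pos hpa hqa) ((div_le_iff₀ hqa).2 (h a))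
        nlinarith
  have hsum : HasSum (fun a => p a * Real.log M + q a - p a) (Real.log M) := by
    simpa using ((hp.2.mul_right (Real.log M)).add hq.2).sub hp.2
  calc _ ≤ ∑' a, ENNReal.ofReal (p a * Real.log M + q a - p a) :=
        ENNReal.tsum_le_tsum fun a => ENNReal.ofReal_le_ofReal (key a).2
    _ = ENNReal.ofReal (Real.log M) := by
        rw [← ENNReal.ofReal_tsum_of_nonneg (fun a => (key a).1.trans (key a).2) hsum.summable,
          hsum.tsum_eq]

/-- A summable function dominating all product pmfs of a class yields, after normalization,
a single coding pmf that bounds both the minimax regret and the minimax redundancy. -/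
theorem minimax_le_of_dominating {α : Type*} {Λ : Set (α → ℝ)} (hΛ : ∀ P ∈ Λ, IsPmf P) {n : ℕ}
    {g : (Fin n → α) → ℝ} {S M : ℝ} (hg : ∀ x, 0 ≤ g x) (hS : HasSum g S) (hpos : 0 < S)
    (hSM : S ≤ M) (hdom : ∀ P ∈ Λ, ∀ x, prodPmf P n x ≤ g x) :
    minimaxRegret Λ n ≤ ENNReal.ofReal (Real.logb 2 M) ∧
      minimaxRedundancy Λ n ≤ ENNReal.ofReal (Real.logb 2 M) := by
  have hQ : IsPmf fun x => g x / S :=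
    ⟨fun x => div_nonneg (hg x) hpos.le, by simpa [hpos.ne'] using hS.div_const S⟩
  have hle : ∀ P ∈ Λ, ∀ x, prodPmf P n x ≤ M * (g x / S) := by
    intro P hP x
    refine (hdom P hP x).trans ?_
    rw [mul_div_assoc', le_div_iff₀ hpos, mul_comm]
    exact mul_le_mul_of_nonneg_right hSM (hg x)
  have hM : 0 < M := hpos.trans_le hSM
  constructor
  · exact (iInf₂_le _ hQ).trans
      (iSup_le fun x => iSup₂_le fun P hP => regretTerm_le_of_le_mul hM (hle P hP x))
  · refine (iInf₂_le _ hQ).trans (iSup₂_le fun P hP => klDiv2_le_of_le_mul ?_ hQ hM (hle P hP))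
    exact ⟨prodPmf_nonneg (hΛ P hP).1 n, by simpa using hasSum_prodPmf (hΛ P hP).1 (hΛ P hP).2 n⟩

/-- The function on `ℕ+` equal to `m / n` on the first `K` symbols and to the
exponential envelope beyond them. -/
def gridFun (alpha C : ℝ) (n K : ℕ) (m : Fin K → ℕ) (k : ℕ+) : ℝ :=
  if h : k.natPred < K then (m ⟨k.natPred, h⟩ : ℝ) / n
  else C * Real.exp (-alpha * (k : ℝ))

theorem gridFun_nonneg {alpha C : ℝ} (hC : 0 < C) (n K : ℕ) (m : Fin K → ℕ) (k : ℕ+) :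
    0 ≤ gridFun alpha C n K m k := by
  unfold gridFun
  split_ifs <;> positivity

theorem hasSum_gridFun {alpha : ℝ} (halpha : 0 < alpha) (C : ℝ) (n K : ℕ) (m : Fin K → ℕ) :
    HasSum (gridFun alpha C n K m)
      (C * Real.exp (-alpha * (K + 1)) * (1 - Real.exp (-alpha))⁻¹ + (∑ j, (m j : ℝ)) / n) := by
  rw [← Equiv.pnatEquivNat.symm.hasSum_iff]
  have hhead : (∑ j, (m j : ℝ)) / n =
      ∑ i ∈ Finset.range K, (gridFun alpha C n K m ∘ Equiv.pnatEquivNat.symm) i := by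
    rw [Finset.sum_range, Finset.sum_div]
    refine Finset.sum_congr rfl fun j _ => ?_
    simp [gridFun]
  rw [hhead, ← hasSum_nat_add_iff K]
  have hgeo := (hasSum_geometric_of_lt_one (Real.exp_nonneg (-alpha))
    (Real.exp_lt_one_iff.2 (by linarith))).mul_left (C * Real.exp (-alpha * (K + 1)))
  refine hgeo.congr_fun fun i => ?_
  simp only [gridFun, Function.comp_apply, Equiv.pnatEquivNat_symm_apply]
  rw [dif_neg (by simp), mul_assoc, ← Real.exp_nat_mul, ← Real.exp_add]
  congr 2
  push_cast [Nat.succPNat_coe]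
  ring

theorem sum_ceil_le_of_isPmf {P : ℕ+ → ℝ} (hP : IsPmf P) (n K : ℕ) :
    ∑ j : Fin K, ⌈n * P (Nat.succPNat j)⌉₊ ≤ n + K := by
  have h1 : ∑ j : Fin K, P (Nat.succPNat j) ≤ 1 := by
    have h2 : HasSum (fun j => P (Nat.succPNat j)) 1 := Equiv.pnatEquivNat.symm.hasSum_iff.2 hP.2
    rw [← Finset.sum_range fun j => P (Nat.succPNat j)]
    exact sum_le_hasSum _ (fun j _ => hP.1 _) h2
  have h3 : ∑ j : Fin K, (⌈n * P (Nat.succPNat j)⌉₊ : ℝ) ≤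
      ∑ j : Fin K, (n * P (Nat.succPNat j) + 1) :=
    Finset.sum_le_sum fun j _ => (Nat.ceil_lt_add_one (mul_nonneg n.cast_nonneg (hP.1 _))).le
  rw [Finset.sum_add_distrib, ← Finset.mul_sum] at h3
  have h4 : (n : ℝ) * ∑ j : Fin K, P (Nat.succPNat j) ≤ n * 1 :=
    mul_le_mul_of_nonneg_left h1 n.cast_nonneg
  simp only [Finset.sum_const, Finset.card_univ, Fintype.card_fin, nsmul_eq_mul] at h3
  have h5 : ((∑ j : Fin K, ⌈n * P (Nat.succPNat j)⌉₊ : ℕ) : ℝ) ≤ ((n + K : ℕ) : ℝ) := by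
    push_cast
    linarith
  exact_mod_cast h5

theorem le_gridFun_ceil {alpha C : ℝ} {P : ℕ+ → ℝ}
    (hP : ∀ k : ℕ+, P k ≤ C * Real.exp (-alpha * (k : ℝ))) {n : ℕ} (hn : 0 < n) (K : ℕ) (k : ℕ+) :
    P k ≤ gridFun alpha C n K (fun j => ⌈n * P (Nat.succPNat j)⌉₊) k := by
  unfold gridFun
  split_ifs with h
  · rw [le_div_iff₀ (by positivity), mul_comm]
    simpa using Nat.le_ceil ((n : ℝ) * P k)
  · exact hP k

/-- Bound obtained by covering the class with the grid functions whose first `K` values are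
multiples of `1 / n`. -/
theorem minimax_expEnvelope_le {alpha C : ℝ} (halpha : 0 < alpha) (hC : 0 < C) {n : ℕ}
    (hn : 0 < n) (K : ℕ) :
    let M := (∏ j : Fin K, (⌈n * (C * Real.exp (-alpha * (j + 1)))⌉₊ + 1 : ℝ)) *
      Real.exp (K + n * (C * Real.exp (-alpha * (K + 1)) * (1 - Real.exp (-alpha))⁻¹))
    minimaxRegret (envClass fun k : ℕ+ => min 1 (C * Real.exp (-alpha * (k : ℝ)))) n ≤
        ENNReal.ofReal (Real.logb 2 M) ∧
      minimaxRedundancy (envClass fun k : ℕ+ => min 1 (C * Real.exp (-alpha * (k : ℝ)))) n ≤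
        ENNReal.ofReal (Real.logb 2 M) := by
  intro M
  set b : Fin K → ℕ := fun j => ⌈n * (C * Real.exp (-alpha * (j + 1)))⌉₊ with hb
  set T : Finset (Fin K → ℕ) :=
    (Fintype.piFinset fun j => Finset.range (b j + 1)).filter fun m => ∑ j, m j ≤ n + K with hT
  set t : ℝ := C * Real.exp (-alpha * (K + 1)) * (1 - Real.exp (-alpha))⁻¹ with ht
  have hexp : Real.exp (-alpha) < 1 := Real.exp_lt_one_iff.2 (by linarith)
  have htpos : 0 < t := by
    have : 0 < 1 - Real.exp (-alpha) := by linarith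
    positivity
  have hn' : (0 : ℝ) < n := by exact_mod_cast hn
  have hgrid := gridFun_nonneg (alpha := alpha) hC n K
  refine minimax_le_of_dominating (fun P hP => hP.1)
    (g := fun x => ∑ m ∈ T, prodPmf (gridFun alpha C n K m) n x)
    (S := ∑ m ∈ T, (t + (∑ j, (m j : ℝ)) / n) ^ n) ?_ ?_ ?_ ?_ ?_
  · exact fun x => Finset.sum_nonneg fun m _ => prodPmf_nonneg (hgrid m) n x
  · exact hasSum_sum fun m _ => hasSum_prodPmf (hgrid m) (hasSum_gridFun halpha C n K m) n
  · refine Finset.sum_pos (fun m _ => by positivity) ⟨0, ?_⟩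
    simp [hT]
  · have hterm : ∀ m ∈ T, (t + (∑ j, (m j : ℝ)) / n) ^ n ≤ Real.exp (K + n * t) := by
      intro m hm
      have hm2 : ∑ j, (m j : ℝ) ≤ n + K := by exact_mod_cast (Finset.mem_filter.1 hm).2
      have h1 : t + (∑ j, (m j : ℝ)) / n ≤ (K + n * t) / n + 1 := by
        rw [← sub_nonneg]
        have : (K + n * t) / n + 1 - (t + (∑ j, (m j : ℝ)) / n) =
            (n + K - ∑ j, (m j : ℝ)) / n := by
          field_simp
          ring
        rw [this]
        exact div_nonneg (by linarith) hn'.le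
      calc (t + (∑ j, (m j : ℝ)) / n) ^ n ≤ Real.exp ((K + n * t) / n) ^ n :=
            pow_le_pow_left₀ (by positivity) (h1.trans (Real.add_one_le_exp _)) n
        _ = Real.exp (K + n * t) := by
            rw [← Real.exp_nat_mul, mul_div_cancel₀ _ hn'.ne']
    have hcard : (T.card : ℝ) ≤ ∏ j, ((b j : ℝ) + 1) := by
      have h1 : T.card ≤ ∏ j, (b j + 1) := by
        refine (Finset.card_filter_le _ _).trans_eq ?_
        simp [Fintype.card_piFinset]
      exact_mod_cast h1
    calc _ ≤ T.card • Real.exp (K + n * t) := Finset.sum_le_card_nsmul _ _ _ hterm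
      _ ≤ M := by
        rw [nsmul_eq_mul]
        exact mul_le_mul_of_nonneg_right hcard (Real.exp_nonneg _)
  · intro P hP x
    have hPf : ∀ k : ℕ+, P k ≤ C * Real.exp (-alpha * (k : ℝ)) :=
      fun k => (hP.2 k).trans (min_le_right _ _)
    set m : Fin K → ℕ := fun j => ⌈n * P (Nat.succPNat j)⌉₊ with hm
    have hmT : m ∈ T := by
      refine Finset.mem_filter.2 ⟨Fintype.mem_piFinset.2 fun j => ?_, sum_ceil_le_of_isPmf hP.1 n K⟩
      rw [Finset.mem_range, Nat.lt_succ_iff]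
      refine Nat.ceil_le_ceil (mul_le_mul_of_nonneg_left ?_ hn'.le)
      simpa using hPf (Nat.succPNat j)
    calc prodPmf P n x ≤ prodPmf (gridFun alpha C n K m) n x :=
          Finset.prod_le_prod (fun i _ => hP.1.1 _) fun i _ => le_gridFun_ceil hPf hn K _
      _ ≤ _ := Finset.single_le_sum
          (f := fun m => prodPmf (gridFun alpha C n K m) n x)
          (fun m _ => prodPmf_nonneg (hgrid m) n x) hmT

/-- With about `log n / alpha` grid coordinates, the grid bound is
`(log n)² / (2 alpha) + O(log n)` in nats. -/
theorem log_gridBound_le {alpha C : ℝ} (halpha : 0 < alpha) (hC : 0 < C) {n : ℕ} (hn : 0 < n)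
    {K : ℕ} (hK : K = ⌈Real.log n / alpha⌉₊) :
    Real.log ((∏ j : Fin K, (⌈n * (C * Real.exp (-alpha * (j + 1)))⌉₊ + 1 : ℝ)) *
      Real.exp (K + n * (C * Real.exp (-alpha * (K + 1)) * (1 - Real.exp (-alpha))⁻¹))) ≤
    Real.log n ^ 2 / (2 * alpha) +
      (Real.log n / alpha + 1) * (Real.log (C + 2 * Real.exp alpha) + 1) +
      C * (1 - Real.exp (-alpha))⁻¹ := by
  set l := Real.log n with hl
  set D := C + 2 * Real.exp alpha with hD
  have hn' : (0 : ℝ) < n := by exact_mod_cast hn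
  have hl0 : 0 ≤ l := Real.log_natCast_nonneg n
  have hexpl : Real.exp l = n := Real.exp_log hn'
  have hK1 : l / alpha ≤ K := hK ▸ Nat.le_ceil _
  have hK2 : (K : ℝ) ≤ l / alpha + 1 := hK ▸ (Nat.ceil_lt_add_one (by positivity)).le
  have hlK : l ≤ alpha * K := by rwa [div_le_iff₀' halpha] at hK1
  have hKl : alpha * K ≤ l + alpha := by
    have := mul_le_mul_of_nonneg_left hK2 halpha.le
    rwa [mul_add, mul_div_cancel₀ _ halpha.ne', mul_one] at this
  have hD1 : 1 ≤ D := by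
    have := Real.one_le_exp halpha.le
    linarith
  have hlogD : 0 ≤ Real.log D := Real.log_nonneg hD1
  have hr : 0 < (1 - Real.exp (-alpha))⁻¹ :=
    inv_pos.2 (sub_pos.2 (Real.exp_lt_one_iff.2 (by linarith)))
  have hfactor : ∀ j : Fin K, Real.log (⌈n * (C * Real.exp (-alpha * (j + 1)))⌉₊ + 1 : ℝ) ≤
      Real.log D + l - alpha * (j + 1) := by
    intro j
    have hjK : ((j : ℕ) : ℝ) + 1 ≤ K := by exact_mod_cast j.2
    have h1 : (1 : ℝ) ≤ Real.exp alpha * (n * Real.exp (-alpha * (j + 1))) := by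
      rw [← hexpl, ← Real.exp_add, ← Real.exp_add]
      refine Real.one_le_exp ?_
      nlinarith
    have h2 : (⌈n * (C * Real.exp (-alpha * (j + 1)))⌉₊ + 1 : ℝ) ≤
        D * n * Real.exp (-alpha * (j + 1)) := by
      have h3 := (Nat.ceil_lt_add_one
        (show 0 ≤ n * (C * Real.exp (-alpha * ((j : ℕ) + 1))) by positivity)).le
      rw [hD]
      linarith
    refine (Real.log_le_log (by positivity) h2).trans_eq ?_
    rw [Real.log_mul (by positivity) (by positivity), Real.log_mul (by positivity) (by positivity),
      Real.log_exp]
    ring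
  have hprod : ∑ j : Fin K, (Real.log D + l - alpha * (((j : ℕ) : ℝ) + 1)) =
      K * (Real.log D + l) - alpha * (K * (K + 1) / 2) := by
    have hgauss : ∀ N : ℕ, ∑ j ∈ Finset.range N, ((j : ℝ) + 1) = N * (N + 1) / 2 := by
      intro N
      induction N with
      | zero => simp
      | succ N ih =>
        rw [Finset.sum_range_succ, ih]
        push_cast
        ring
    rw [← Finset.sum_range fun j => Real.log D + l - alpha * ((j : ℝ) + 1),
      Finset.sum_sub_distrib, ← Finset.mul_sum, hgauss, Finset.sum_const, Finset.card_range,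
      nsmul_eq_mul]
  have htail : n * (C * Real.exp (-alpha * (K + 1)) * (1 - Real.exp (-alpha))⁻¹) ≤
      C * (1 - Real.exp (-alpha))⁻¹ := by
    have h1 : n * Real.exp (-alpha * (K + 1)) ≤ 1 := by
      rw [← hexpl, ← Real.exp_add]
      refine Real.exp_le_one_iff.2 ?_
      linarith
    calc _ = C * (1 - Real.exp (-alpha))⁻¹ * (n * Real.exp (-alpha * (K + 1))) := by ring
      _ ≤ _ := mul_le_of_le_one_right (by positivity) h1
  have hsquare : K * l - alpha * (K * (K + 1) / 2) ≤ l ^ 2 / (2 * alpha) := by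
    have h1 : l ^ 2 / (2 * alpha) - (K * l - alpha * (K * (K + 1) / 2)) =
        (l - alpha * K) ^ 2 / (2 * alpha) + alpha * K / 2 := by
      field_simp
      ring
    have h2 : 0 ≤ (l - alpha * K) ^ 2 / (2 * alpha) + alpha * K / 2 := by positivity
    linarith
  rw [Real.log_mul (Finset.prod_ne_zero_iff.2 fun j _ => by positivity) (Real.exp_ne_zero _),
    Real.log_exp, Real.log_prod fun j _ => by positivity]
  have hsum := Finset.sum_le_sum fun j (_ : j ∈ Finset.univ) => hfactor j
  rw [hprod] at hsum
  have hlin := mul_le_mul_of_nonneg_right hK2 (add_nonneg hlogD zero_le_one)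
  linarith

/-- upper bounds on minimax regret and redundancy for exponential
envelope classes. -/
theorem stmt13 (alpha C : ℝ) (halpha : 0 < alpha) (hC : Real.exp (2 * alpha) < C) :
    ∃ B : ℝ, ∀ n : ℕ, 2 ≤ n →
      minimaxRegret
          (envClass fun k : ℕ+ => min 1 (C * Real.exp (-alpha * (k : ℝ)))) n ≤
        ENNReal.ofReal (1 / (2 * alpha) * Real.logb 2 (n : ℝ) ^ 2 + B) ∧
      minimaxRedundancy
          (envClass fun k : ℕ+ => min 1 (C * Real.exp (-alpha * (k : ℝ)))) n ≤
        ENNReal.ofReal (1 / (2 * alpha) * Real.logb 2 (n : ℝ) ^ 2 + B) := by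
  have hC0 : 0 < C := (Real.exp_pos _).trans hC
  have hlog2 : 0 < Real.log 2 := Real.log_pos one_lt_two
  have hlog2' : Real.log 2 < 1 := by linarith [Real.log_two_lt_d9]
  set A := Real.log (C + 2 * Real.exp alpha) + 1 with hA
  set c := C * (1 - Real.exp (-alpha))⁻¹ with hc
  set δ := (1 - Real.log 2) / (2 * alpha) with hδ
  have hδpos : 0 < δ := div_pos (by linarith) (by linarith)
  refine ⟨(A + c) / Real.log 2 + (A / alpha) ^ 2 / (4 * δ), fun n hn => ?_⟩
  have hn0 : 0 < n := by omega
  have hbound := log_gridBound_le halpha hC0 hn0 rfl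
  obtain ⟨h1, h2⟩ := minimax_expEnvelope_le halpha hC0 hn0 ⌈Real.log n / alpha⌉₊
  rw [← hA, ← hc] at hbound
  have hfinal := div_le_div_of_nonneg_right hbound hlog2.le
  rw [Real.log_div_log] at hfinal
  set L := Real.logb 2 n with hL
  have hlogn : Real.log n = L * Real.log 2 := by
    rw [hL, Real.logb, div_mul_cancel₀ _ hlog2.ne']
  have hrhs : ((Real.log n ^ 2 / (2 * alpha) + (Real.log n / alpha + 1) * A + c) / Real.log 2) ≤
      1 / (2 * alpha) * L ^ 2 + ((A + c) / Real.log 2 + (A / alpha) ^ 2 / (4 * δ)) := by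
    have hsq : 0 ≤ (2 * δ * L - A / alpha) ^ 2 / (4 * δ) := by positivity
    have hexpand : (2 * δ * L - A / alpha) ^ 2 / (4 * δ) =
        δ * L ^ 2 - A / alpha * L + (A / alpha) ^ 2 / (4 * δ) := by
      field_simp
      ring
    have hlhs : (Real.log n ^ 2 / (2 * alpha) + (Real.log n / alpha + 1) * A + c) / Real.log 2 =
        1 / (2 * alpha) * L ^ 2 - δ * L ^ 2 + A / alpha * L + (A + c) / Real.log 2 := by
      rw [hlogn, hδ]
      field_simp
      ring
    linarith
  have hmono := ENNReal.ofReal_le_ofReal (hfinal.trans hrhs)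
  exact ⟨h1.trans hmono, h2.trans hmono⟩
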